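/- arXiv:1808.01800 — 2 statements merged into one kernel-verified Lean document; each statement's English description precedes it below -/
import Mathlib

section
/- The Cartesian product K_n □ K_2 has representation number n for n = 1, 2, 3, and representation number 3 for all n > 3. That is: K_1 □ K_2 has representation number 1, K_2 □ K_2 has representation number 2, and for every n ≥ 3, K_n □ K_2 has representation number 3. -/
open SimpleGraph

variable {V V' : Type*}

/-- Two letters `x` and `y` alternate in the word `w` if the word obtained from `w` by
deleting all letters other than `x` and `y` has no two consecutive equal letters. -/
def alternate [DecidableEq V] (w : List V) (x y : V) : Prop :=
  (w.filter (fun z => decide (z = x ∨ z = y))).Chain' (· ≠ ·)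

/-- A word `w` over the alphabet `V` represents the graph `G`: every letter of the
alphabet occurs in `w`, and two distinct letters alternate in `w` iff they are
adjacent in `G`. -/
def represents [DecidableEq V] (G : SimpleGraph V) (w : List V) : Prop :=
  (∀ x : V, x ∈ w) ∧ ∀ x y : V, x ≠ y → (alternate w x y ↔ G.Adj x y)

/-- A word is `k`-uniform if every letter of the alphabet occurs exactly `k` times. -/
def uniform [DecidableEq V] (k : ℕ) (w : List V) : Prop :=
  ∀ x : V, w.count x = k

/-- Label each letter with its occurrence number (`1`-based): the `i`th occurrence
of the letter `x` in `w` becomes the pair `(x, i)`. -/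
def labelAux [DecidableEq V] (c : V → ℕ) : List V → List (V × ℕ)
  | [] => []
  | x :: xs => (x, c x + 1) :: labelAux (Function.update c x (c x + 1)) xs

/-- The labelled version of a word. -/
def label [DecidableEq V] (w : List V) : List (V × ℕ) := labelAux (fun _ => 0) w

/-- `pA A w` keeps, for each letter `x`, exactly the `i`th occurrences of `x` for
`i ∈ A`, and deletes all other occurrences. -/
def pA [DecidableEq V] (A : Finset ℕ) (w : List V) : List V :=
  ((label w).filter (fun p => decide (p.2 ∈ A))).map Prod.fst

/-- Applying an occurrence-based function `h` to a word `w`: the `i`th occurrence of a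
letter `x` in `w` is replaced by the string `h x i`. -/
def obf [DecidableEq V] (h : V → ℕ → List V') (w : List V) : List V' :=
  (label w).flatMap (fun p => h p.1 p.2)

/-- The representation number of a graph: the minimum `k` such that some `k`-uniform
word represents `G`. -/
noncomputable def repNum [DecidableEq V] (G : SimpleGraph V) : ℕ :=
  sInf {k | ∃ w : List V, uniform k w ∧ represents G w}

/-! ### Uniform words with few occurrences of each letter -/

theorem length_eq_count_add_count [DecidableEq V] {x y : V} (hxy : x ≠ y) :
    ∀ u : List V, (∀ z ∈ u, z = x ∨ z = y) → u.length = u.count x + u.count y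
  | [], _ => by simp
  | z :: u, h => by
    have ih := length_eq_count_add_count hxy u fun v hv => h v (List.mem_cons_of_mem _ hv)
    rcases h z List.mem_cons_self with rfl | rfl
    · simp [hxy, ih]; omega
    · simp [hxy.symm, ih]; omega

theorem uniform_of_length_filter [DecidableEq V] {k : ℕ} {w : List V}
    (h : ∀ x, (w.filter fun z => decide (z = x ∨ z = x)).length = k) : uniform k w := by
  intro x
  rw [← h x, ← List.countP_eq_length_filter]
  exact List.countP_congr fun z _ => by simp

theorem mem_of_uniform [DecidableEq V] {k : ℕ} (hk : 0 < k) {w : List V} (hw : uniform k w)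
    (x : V) : x ∈ w :=
  List.count_pos_iff.1 (hk.trans_eq (hw x).symm)

theorem length_filter_of_uniform [DecidableEq V] {k : ℕ} {w : List V} (hw : uniform k w)
    {x y : V} (hxy : x ≠ y) :
    (w.filter fun z => decide (z = x ∨ z = y)).length = k + k := by
  rw [length_eq_count_add_count hxy, List.count_filter, List.count_filter, hw, hw] <;> simp

theorem alternate_of_uniform_one [DecidableEq V] {w : List V} (hw : uniform 1 w)
    {x y : V} (hxy : x ≠ y) : alternate w x y := by
  have hl := length_filter_of_uniform hw hxy
  have hx : (w.filter fun z => decide (z = x ∨ z = y)).count x = 1 := by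
    rw [List.count_filter (by simp), hw]
  have hmem : ∀ z ∈ w.filter fun z => decide (z = x ∨ z = y), z = x ∨ z = y := by simp
  have hyx := hxy.symm
  unfold alternate
  generalize (w.filter fun z => decide (z = x ∨ z = y)) = u at *
  obtain ⟨a, b, rfl⟩ := List.length_eq_two.1 hl
  rcases hmem a (by simp) with rfl | rfl <;> rcases hmem b (by simp) with rfl | rfl <;>
    simp_all [List.Chain']

theorem alternate_iff_sublist_of_uniform_two [DecidableEq V] {w : List V} (hw : uniform 2 w)
    {x y : V} (hxy : x ≠ y) :
    alternate w x y ↔ [x, y, x, y].Sublist w ∨ [y, x, y, x].Sublist w := by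
  have hl := length_filter_of_uniform hw hxy
  have hx : (w.filter fun z => decide (z = x ∨ z = y)).count x = 2 := by
    rw [List.count_filter (by simp), hw]
  have hmem : ∀ z ∈ w.filter fun z => decide (z = x ∨ z = y), z = x ∨ z = y := by simp
  have hsub : ∀ l : List V, (∀ z ∈ l, z = x ∨ z = y) → l.length = 4 →
      (l.Sublist w ↔ l = w.filter fun z => decide (z = x ∨ z = y)) := by
    intro l h h4
    refine ⟨fun hs => ?_, fun h => h ▸ List.filter_sublist⟩
    refine List.Sublist.eq_of_length ?_ (h4.trans hl.symm)
    have := hs.filter (fun z => decide (z = x ∨ z = y))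
    rwa [List.filter_eq_self.2 (by simpa using h)] at this
  rw [hsub _ (by simp) rfl, hsub _ (by simp) rfl]
  have hyx := hxy.symm
  unfold alternate
  generalize (w.filter fun z => decide (z = x ∨ z = y)) = u at *
  match u, hl with
  | [a, b, c, d], _ =>
    rcases hmem a (by simp) with rfl | rfl <;> rcases hmem b (by simp) with rfl | rfl <;>
      rcases hmem c (by simp) with rfl | rfl <;> rcases hmem d (by simp) with rfl | rfl <;>
      simp_all [List.Chain']

theorem cons_sublist_drop_iff {a : V} {u w : List V} {k : ℕ} :
    (a :: u).Sublist (w.drop k) ↔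
      ∃ i, k ≤ i ∧ w[i]? = some a ∧ u.Sublist (w.drop (i + 1)) := by
  constructor
  · intro h
    obtain ⟨r₁, r₂, he, ha, hu⟩ := List.cons_sublist_iff.1 h
    obtain ⟨j, hj, rfl⟩ := List.getElem_of_mem ha
    refine ⟨k + j, by omega, ?_, ?_⟩
    · rw [← List.getElem?_drop, he, List.getElem?_append_left hj, List.getElem?_eq_getElem hj]
    · rw [show k + j + 1 = k + (j + 1) by omega, ← List.drop_drop, he,
        List.drop_append_of_le_length (by omega)]
      exact hu.trans (List.sublist_append_right _ _)
  · rintro ⟨i, hi, hw, hu⟩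
    obtain ⟨hlt, rfl⟩ := List.getElem?_eq_some_iff.1 hw
    refine List.Sublist.trans ?_ (List.drop_sublist_drop_left w hi)
    rw [List.drop_eq_getElem_cons hlt]
    exact hu.cons_cons _

theorem exists_positions_of_count_eq_two [DecidableEq V] {w : List V} {x : V}
    (h : w.count x = 2) :
    ∃ p q : ℕ, p < q ∧ ∀ i, w[i]? = some x ↔ i = p ∨ i = q := by
  have hs : [x, x].Sublist (w.drop 0) := by
    simpa using (List.replicate_sublist_iff (n := 2)).2 h.ge
  obtain ⟨p, -, hp, hs⟩ := cons_sublist_drop_iff.1 hs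
  obtain ⟨q, hpq, hq, -⟩ := cons_sublist_drop_iff.1 hs
  have three : ∀ i j k : ℕ, i < j → j < k → w[i]? = some x → w[j]? = some x →
      w[k]? = some x → False := by
    intro i j k hij hjk hi hj hk
    have : [x, x, x].Sublist (w.drop 0) :=
      cons_sublist_drop_iff.2 ⟨i, by omega, hi, cons_sublist_drop_iff.2 ⟨j, hij, hj,
        cons_sublist_drop_iff.2 ⟨k, hjk, hk, List.nil_sublist _⟩⟩⟩
    have := (List.replicate_sublist_iff (n := 3) (a := x) (l := w)).1 (by simpa using this)
    omega
  refine ⟨p, q, hpq, fun i => ⟨fun hi => ?_, by rintro (rfl | rfl) <;> assumption⟩⟩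
  by_contra! hne
  obtain h | h | h : i < p ∨ (p < i ∧ i < q) ∨ q < i := by omega
  · exact three i p q h hpq hi hp hq
  · exact three p i q h.1 h.2 hp hi hq
  · exact three p q i hpq h hp hq hi

/-- The intervals `[p, q]` and `[r, s]` overlap without one containing the other. -/
def crossing (p q r s : ℕ) : Prop :=
  (p < r ∧ r < q ∧ q < s) ∨ (r < p ∧ p < s ∧ s < q)

theorem alternate_iff_crossing [DecidableEq V] {w : List V} (hw : uniform 2 w)
    {x y : V} (hxy : x ≠ y) {p q r s : ℕ} (hpq : p < q) (hrs : r < s)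
    (hx : ∀ i, w[i]? = some x ↔ i = p ∨ i = q) (hy : ∀ i, w[i]? = some y ↔ i = r ∨ i = s) :
    alternate w x y ↔ crossing p q r s := by
  rw [alternate_iff_sublist_of_uniform_two hw hxy, ← List.drop_zero (l := w)]
  simp only [cons_sublist_drop_iff, hx, hy, List.nil_sublist, and_true]
  unfold crossing
  constructor
  · rintro (⟨i, -, hi, j, hij, hj, k, hjk, hk, l, hkl, hl⟩ |
      ⟨i, -, hi, j, hij, hj, k, hjk, hk, l, hkl, hl⟩) <;> omega
  · rintro (h | h)
    · exact .inl ⟨p, by omega, by omega, r, by omega, by omega, q, by omega, by omega,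
        s, by omega, by omega⟩
    · exact .inr ⟨r, by omega, by omega, p, by omega, by omega, s, by omega, by omega,
        q, by omega, by omega⟩

/-! ### The triangular prism is not a circle graph -/

theorem location_of_ne {a b c d e f r : ℕ}
    (hr : r ≠ a ∧ r ≠ b ∧ r ≠ c ∧ r ≠ d ∧ r ≠ e ∧ r ≠ f) :
    r < a ∨ (a < r ∧ r < b) ∨ (b < r ∧ r < c) ∨ (c < r ∧ r < d) ∨ (d < r ∧ r < e) ∨
      (e < r ∧ r < f) ∨ f < r := by
  omega

/-- A chord crossing exactly the first of three mutually crossing chords stays next to one of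
the two ends of that chord. The chord has ends `r < s`, and the points `a < b < c < d < e < f`
are the ends of the three chords `ad`, `be` and `cf`. -/
theorem chord_near_first {a b c d e f r s : ℕ} (hab : a < b) (hbc : b < c) (hcd : c < d)
    (hde : d < e) (hef : e < f) (hrs : r < s)
    (hr : r ≠ a ∧ r ≠ b ∧ r ≠ c ∧ r ≠ d ∧ r ≠ e ∧ r ≠ f)
    (hs : s ≠ a ∧ s ≠ b ∧ s ≠ c ∧ s ≠ d ∧ s ≠ e ∧ s ≠ f)
    (h₁ : crossing a d r s) (h₂ : ¬ crossing b e r s) (h₃ : ¬ crossing c f r s) :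
    (r < a ∧ a < s ∧ s < b) ∨ (a < r ∧ r < b ∧ f < s) ∨ (c < r ∧ r < d ∧ d < s ∧ s < e) := by
  have hr' := location_of_ne hr
  have hs' := location_of_ne hs
  clear hr hs
  unfold crossing at *
  rcases hr' with h | h | h | h | h | h | h <;> rcases hs' with g | g | g | g | g | g | g <;>
    omega

/-- A chord crossing exactly the second of three mutually crossing chords stays next to one of
the two ends of that chord. The chord has ends `r < s`, and the points `a < b < c < d < e < f`
are the ends of the three chords `ad`, `be` and `cf`. -/
theorem chord_near_second {a b c d e f r s : ℕ} (hab : a < b) (hbc : b < c) (hcd : c < d)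
    (hde : d < e) (hef : e < f) (hrs : r < s)
    (hr : r ≠ a ∧ r ≠ b ∧ r ≠ c ∧ r ≠ d ∧ r ≠ e ∧ r ≠ f)
    (hs : s ≠ a ∧ s ≠ b ∧ s ≠ c ∧ s ≠ d ∧ s ≠ e ∧ s ≠ f)
    (h₁ : ¬ crossing a d r s) (h₂ : crossing b e r s) (h₃ : ¬ crossing c f r s) :
    (a < r ∧ r < b ∧ b < s ∧ s < c) ∨ (d < r ∧ r < e ∧ e < s ∧ s < f) := by
  have hr' := location_of_ne hr
  have hs' := location_of_ne hs
  clear hr hs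
  unfold crossing at *
  rcases hr' with h | h | h | h | h | h | h <;> rcases hs' with g | g | g | g | g | g | g <;>
    omega

/-- A chord crossing exactly the third of three mutually crossing chords stays next to one of
the two ends of that chord. The chord has ends `r < s`, and the points `a < b < c < d < e < f`
are the ends of the three chords `ad`, `be` and `cf`. -/
theorem chord_near_third {a b c d e f r s : ℕ} (hab : a < b) (hbc : b < c) (hcd : c < d)
    (hde : d < e) (hef : e < f) (hrs : r < s)
    (hr : r ≠ a ∧ r ≠ b ∧ r ≠ c ∧ r ≠ d ∧ r ≠ e ∧ r ≠ f)
    (hs : s ≠ a ∧ s ≠ b ∧ s ≠ c ∧ s ≠ d ∧ s ≠ e ∧ s ≠ f)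
    (h₁ : ¬ crossing a d r s) (h₂ : ¬ crossing b e r s) (h₃ : crossing c f r s) :
    (b < r ∧ r < c ∧ c < s ∧ s < d) ∨ (e < r ∧ r < f ∧ f < s) ∨ (r < a ∧ e < s ∧ s < f) := by
  have hr' := location_of_ne hr
  have hs' := location_of_ne hs
  clear hr hs
  unfold crossing at *
  rcases hr' with h | h | h | h | h | h | h <;> rcases hs' with g | g | g | g | g | g | g <;>
    omega

theorem not_prism_crossing_of_lt {p q r s : Fin 3 → ℕ} {i j k : Fin 3}
    (hij : i ≠ j) (hik : i ≠ k) (hjk : j ≠ k) (hpi : p i < p j) (hpj : p j < p k)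
    (hrs : ∀ i, r i < s i)
    (hdist : ∀ i j, p i ≠ r j ∧ p i ≠ s j ∧ q i ≠ r j ∧ q i ≠ s j)
    (ha : ∀ i j, i ≠ j → crossing (p i) (q i) (p j) (q j))
    (hb : ∀ i j, i ≠ j → crossing (r i) (s i) (r j) (s j))
    (hab : ∀ i j, crossing (p i) (q i) (r j) (s j) ↔ i = j) : False := by
  have hord : p k < q i ∧ q i < q j ∧ q j < q k := by
    have := ha i j hij
    have := ha i k hik
    have := ha j k hjk
    unfold crossing at *
    omega
  obtain ⟨o₁, o₂, o₃⟩ := hord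
  have hr : ∀ l, r l ≠ p i ∧ r l ≠ p j ∧ r l ≠ p k ∧ r l ≠ q i ∧ r l ≠ q j ∧ r l ≠ q k :=
    fun l => ⟨(hdist i l).1.symm, (hdist j l).1.symm, (hdist k l).1.symm,
      (hdist i l).2.2.1.symm, (hdist j l).2.2.1.symm, (hdist k l).2.2.1.symm⟩
  have hs : ∀ l, s l ≠ p i ∧ s l ≠ p j ∧ s l ≠ p k ∧ s l ≠ q i ∧ s l ≠ q j ∧ s l ≠ q k :=
    fun l => ⟨(hdist i l).2.1.symm, (hdist j l).2.1.symm, (hdist k l).2.1.symm,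
      (hdist i l).2.2.2.symm, (hdist j l).2.2.2.symm, (hdist k l).2.2.2.symm⟩
  have l₁ := chord_near_first hpi hpj o₁ o₂ o₃ (hrs i) (hr i) (hs i) ((hab i i).2 rfl)
    (mt (hab j i).1 hij.symm) (mt (hab k i).1 hik.symm)
  have l₂ := chord_near_second hpi hpj o₁ o₂ o₃ (hrs j) (hr j) (hs j) (mt (hab i j).1 hij)
    ((hab j j).2 rfl) (mt (hab k j).1 hjk.symm)
  have l₃ := chord_near_third hpi hpj o₁ o₂ o₃ (hrs k) (hr k) (hs k) (mt (hab i k).1 hik)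
    (mt (hab j k).1 hjk) ((hab k k).2 rfl)
  have b₁ := hb i j hij
  have b₂ := hb i k hik
  have b₃ := hb j k hjk
  unfold crossing at b₁ b₂ b₃
  clear hr hs hdist ha hb hab hrs
  rcases l₁ with l₁ | l₁ | l₁ <;> rcases l₂ with l₂ | l₂ <;> rcases l₃ with l₃ | l₃ | l₃ <;>
    omega

theorem not_prism_crossing {p q r s : Fin 3 → ℕ}
    (hrs : ∀ i, r i < s i)
    (hdist : ∀ i j, p i ≠ r j ∧ p i ≠ s j ∧ q i ≠ r j ∧ q i ≠ s j)
    (ha : ∀ i j, i ≠ j → crossing (p i) (q i) (p j) (q j))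
    (hb : ∀ i j, i ≠ j → crossing (r i) (s i) (r j) (s j))
    (hab : ∀ i j, crossing (p i) (q i) (r j) (s j) ↔ i = j) : False := by
  have key : ∀ i j k : Fin 3, i ≠ j → i ≠ k → j ≠ k → p i < p j → p j < p k → False :=
    fun i j k hij hik hjk hpi hpj =>
      not_prism_crossing_of_lt hij hik hjk hpi hpj hrs hdist ha hb hab
  have hne : ∀ i j, i ≠ j → p i ≠ p j := fun i j h => by
    have := ha i j h
    unfold crossing at this
    omega
  have h01 := hne 0 1 (by decide)
  have h02 := hne 0 2 (by decide)
  have h12 := hne 1 2 (by decide)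
  have k₁ := key 0 1 2 (by decide) (by decide) (by decide)
  have k₂ := key 0 2 1 (by decide) (by decide) (by decide)
  have k₃ := key 1 0 2 (by decide) (by decide) (by decide)
  have k₄ := key 1 2 0 (by decide) (by decide) (by decide)
  have k₅ := key 2 0 1 (by decide) (by decide) (by decide)
  have k₆ := key 2 1 0 (by decide) (by decide) (by decide)
  grind

/-! ### Lower bounds -/

theorem not_represents_of_uniform_zero [DecidableEq V] [Nonempty V] {G : SimpleGraph V}
    {w : List V} (hw : uniform 0 w) : ¬ represents G w := fun h =>
  let ⟨x⟩ := ‹Nonempty V›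
  List.count_eq_zero.1 (hw x) (h.1 x)

theorem not_represents_of_uniform_one [DecidableEq V] {G : SimpleGraph V} {x y : V}
    (hxy : x ≠ y) (hG : ¬ G.Adj x y) {w : List V} (hw : uniform 1 w) : ¬ represents G w :=
  fun h => hG ((h.2 x y hxy).1 (alternate_of_uniform_one hw hxy))

theorem not_represents_prism_of_uniform_two {n : ℕ} (hn : 3 ≤ n) {w : List (Fin n × Fin 2)}
    (hw : uniform 2 w) :
    ¬ represents ((⊤ : SimpleGraph (Fin n)) □ (⊤ : SimpleGraph (Fin 2))) w := by
  intro h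
  choose p q hpq hpos using fun x => exists_positions_of_count_eq_two (hw x)
  have hcross : ∀ x y, x ≠ y → (crossing (p x) (q x) (p y) (q y) ↔
      ((⊤ : SimpleGraph (Fin n)) □ (⊤ : SimpleGraph (Fin 2))).Adj x y) := fun x y hxy => by
    rw [← h.2 x y hxy, alternate_iff_crossing hw hxy (hpq x) (hpq y) (hpos x) (hpos y)]
  have hpw : ∀ x, w[p x]? = some x := fun x => (hpos x _).2 (.inl rfl)
  have hqw : ∀ x, w[q x]? = some x := fun x => (hpos x _).2 (.inr rfl)
  refine not_prism_crossing (p := fun i => p (Fin.castLE hn i, 0))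
    (q := fun i => q (Fin.castLE hn i, 0)) (r := fun i => p (Fin.castLE hn i, 1))
    (s := fun i => q (Fin.castLE hn i, 1)) (fun _ => hpq _) ?_ ?_ ?_ ?_
  · intro i j
    refine ⟨fun e => ?_, fun e => ?_, fun e => ?_, fun e => ?_⟩ <;>
    · have := congrArg (fun l : ℕ => w[l]?) e
      simp [hpw, hqw] at this
  · intro i j hij
    exact (hcross _ _ (by simp [hij])).2 (by simp [boxProd_adj, hij])
  · intro i j hij
    exact (hcross _ _ (by simp [hij])).2 (by simp [boxProd_adj, hij])
  · intro i j
    rw [hcross _ _ (by simp)]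
    simp [boxProd_adj]

/-! ### A 3-uniform word for the prism over a complete graph -/

/-- With `aᵢ = (i, 0)` and `bᵢ = (i, 1)`, the word
`a₁b₁…aₙbₙ a₁…aₙ b₁a₁…bₙaₙ b₁…bₙ`. -/
def prismWord (n : ℕ) : List (Fin n × Fin 2) :=
  (List.finRange n).flatMap (fun i => [(i, 0), (i, 1)]) ++
  ((List.finRange n).flatMap (fun i => [(i, 0)]) ++
  ((List.finRange n).flatMap (fun i => [(i, 1), (i, 0)]) ++
  (List.finRange n).flatMap (fun i => [(i, 1)])))

theorem filter_flatMap_eq_filter_flatMap_filter {α β : Type*} (f : α → List β) (P : β → Bool)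
    (Q : α → Bool) (h : ∀ a, Q a = false → ∀ b ∈ f a, P b = false) (l : List α) :
    (l.flatMap f).filter P = ((l.filter Q).flatMap f).filter P := by
  induction l with
  | nil => rfl
  | cons a l ih =>
    rw [List.flatMap_cons, List.filter_append, ih, List.filter_cons]
    split_ifs with hQ
    · rw [List.flatMap_cons, List.filter_append]
    · rw [List.filter_eq_nil_iff.2, List.nil_append]
      intro b hb
      simpa using h a (by simpa using hQ) b hb

theorem filter_finRange_pair {n : ℕ} {i j : Fin n} (hij : i < j) :
    (List.finRange n).filter (fun k => decide (k = i ∨ k = j)) = [i, j] := by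
  refine List.Perm.eq_of_pairwise' (r := (· < ·)) ?_ ?_ ?_
  · exact (List.pairwise_lt_finRange n).filter _
  · simpa using hij
  · rw [List.perm_ext_iff_of_nodup ((List.nodup_finRange n).filter _) (by simp [hij.ne])]
    simp

theorem filter_finRange_single {n : ℕ} (i : Fin n) :
    (List.finRange n).filter (fun k => decide (k = i ∨ k = i)) = [i] := by
  simp [List.filter_eq, List.count_eq_one_of_mem (List.nodup_finRange n)]

theorem alternate_comm [DecidableEq V] {w : List V} {x y : V} :
    alternate w x y ↔ alternate w y x := by
  simp only [alternate, or_comm]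

theorem filter_prismWord {n : ℕ} (x y : Fin n × Fin 2) {l : List (Fin n)}
    (hl : (List.finRange n).filter (fun k => decide (k = x.1 ∨ k = y.1)) = l) :
    (prismWord n).filter (fun z => decide (z = x ∨ z = y)) =
      (l.flatMap (fun i => [(i, (0 : Fin 2)), (i, 1)]) ++ (l.flatMap (fun i => [(i, 0)]) ++
        (l.flatMap (fun i => [(i, 1), (i, 0)]) ++ l.flatMap (fun i => [(i, 1)])))).filter
          (fun z => decide (z = x ∨ z = y)) := by
  have h : ∀ f : Fin n → List (Fin n × Fin 2), (∀ i, ∀ b ∈ f i, b.1 = i) →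
      ((List.finRange n).flatMap f).filter (fun z => decide (z = x ∨ z = y)) =
        (l.flatMap f).filter (fun z => decide (z = x ∨ z = y)) := by
    intro f hf
    rw [← hl]
    refine filter_flatMap_eq_filter_flatMap_filter _ _ _ ?_ _
    intro a ha b hb
    have := hf a b hb
    simp only [decide_eq_false_iff_not] at ha ⊢
    rintro (rfl | rfl) <;> simp [this] at ha
  simp only [prismWord, List.filter_append]
  rw [h _ (by simp), h _ (by simp), h _ (by simp), h _ (by simp)]

theorem uniform_prismWord (n : ℕ) : uniform 3 (prismWord n) := by
  refine uniform_of_length_filter ?_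
  rintro ⟨i, e⟩
  rw [filter_prismWord (i, e) (i, e) (filter_finRange_single i)]
  fin_cases e <;> simp

theorem alternate_prismWord_of_lt {n : ℕ} {i j : Fin n} (hij : i < j) (e f : Fin 2) :
    alternate (prismWord n) (i, e) (j, f) ↔ e = f := by
  unfold alternate
  rw [filter_prismWord (i, e) (j, f) (filter_finRange_pair hij)]
  fin_cases e <;> fin_cases f <;>
    simp [List.Chain', hij.ne, hij.ne']

theorem alternate_prismWord_self {n : ℕ} (i : Fin n) :
    alternate (prismWord n) (i, 0) (i, 1) := by
  unfold alternate
  rw [filter_prismWord (i, 0) (i, 1) (filter_finRange_single i)]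
  simp [List.Chain']

theorem represents_prismWord (n : ℕ) :
    represents ((⊤ : SimpleGraph (Fin n)) □ (⊤ : SimpleGraph (Fin 2))) (prismWord n) := by
  refine ⟨mem_of_uniform three_pos (uniform_prismWord n), ?_⟩
  rintro ⟨i, e⟩ ⟨j, f⟩ hne
  rcases lt_trichotomy i j with h | rfl | h
  · rw [alternate_prismWord_of_lt h]
    simp [boxProd_adj, h.ne]
  · have hef : e ≠ f := by rintro rfl; exact hne rfl
    have : alternate (prismWord n) (i, e) (i, f) := by
      fin_cases e <;> fin_cases f
      · exact absurd rfl hef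
      · exact alternate_prismWord_self i
      · exact alternate_comm.1 (alternate_prismWord_self i)
      · exact absurd rfl hef
    simp [this, boxProd_adj, hef]
  · rw [alternate_comm, alternate_prismWord_of_lt h]
    simp [boxProd_adj, h.ne', eq_comm]

/-! ### Representation numbers -/

theorem repNum_eq [DecidableEq V] {G : SimpleGraph V} {k : ℕ}
    (h : ∃ w : List V, uniform k w ∧ represents G w)
    (hlt : ∀ m < k, ∀ w : List V, uniform m w → ¬ represents G w) : repNum G = k := by
  refine le_antisymm (Nat.sInf_le h) (le_csInf ⟨k, h⟩ ?_)
  rintro m ⟨w, hw, hr⟩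
  by_contra! hm
  exact hlt m hm w hw hr

theorem stmt8 :
    repNum ((⊤ : SimpleGraph (Fin 1)) □ (⊤ : SimpleGraph (Fin 2))) = 1 ∧
      repNum ((⊤ : SimpleGraph (Fin 2)) □ (⊤ : SimpleGraph (Fin 2))) = 2 ∧
      ∀ n : ℕ, 3 ≤ n →
        repNum ((⊤ : SimpleGraph (Fin n)) □ (⊤ : SimpleGraph (Fin 2))) = 3 := by
  refine ⟨repNum_eq ⟨[(0, 0), (0, 1)], ?_, ?_, ?_⟩ ?_,
    repNum_eq ⟨[(1, 0), (0, 0), (1, 1), (1, 0), (0, 1), (1, 1), (0, 0), (0, 1)], ?_, ?_, ?_⟩ ?_,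
    fun n hn => repNum_eq ⟨prismWord n, uniform_prismWord n, represents_prismWord n⟩ ?_⟩
  · unfold uniform; decide
  · decide
  · simp only [alternate, List.Chain', boxProd_adj, top_adj]; decide
  · intro m hm w hw
    obtain rfl : m = 0 := by omega
    exact not_represents_of_uniform_zero hw
  · unfold uniform; decide
  · decide
  · simp only [alternate, List.Chain', boxProd_adj, top_adj]; decide
  · intro m hm w hw
    interval_cases m
    · exact not_represents_of_uniform_zero hw
    · exact not_represents_of_uniform_one (x := (0, 0)) (y := (1, 1)) (by decide)
        (by simp [boxProd_adj]) hw
  · intro m hm w hw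
    interval_cases m
    · have : Nonempty (Fin n × Fin 2) := ⟨(⟨0, by omega⟩, 0)⟩
      exact not_represents_of_uniform_zero hw
    · have h01 : (⟨0, by omega⟩ : Fin n) ≠ ⟨1, by omega⟩ := by simp
      exact not_represents_of_uniform_one (x := (_, 0)) (y := (_, 1))
        (fun h => h01 (congrArg Prod.fst h)) (by simp [boxProd_adj]) hw
    · exact not_represents_prism_of_uniform_two hn hw
end

section
/- Let G be a graph with vertex set V, let k > 1 and n > 1, and let w be a k-uniform word representing G. Define occurrence-based functions f_1, ..., f_n over the alphabet {x_1, ..., x_n : x ∈ V} by: f_1(x,1) = x_1 and f_1(x,i) = x_n x_{n-1} ⋯ x_1 for 1 < i ≤ k; and for j = 2, ..., n: f_j(x,1) = x_j, f_j(x,2) = x_{j-1} ⋯ x_1 x_n ⋯ x_j, and f_j(x,i) = ε for 2 < i ≤ k. Then the word w' = f_n(w) f_{n-1}(w) ⋯ f_1(w) is a (k+n−1)-uniform word representing the Cartesian product G □ K_n, where x_j denotes the vertex (x, j) of G □ K_n. -/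
open SimpleGraph

variable {V V' : Type*}

/-- The occurrence-based function `f_{a+1}` (for `a : Fin n`) over the alphabet
`V × Fin n`, where `x_j` denotes `(x, j - 1)`:
`f_1(x,1) = x_1` and `f_1(x,i) = x_n x_{n-1} ⋯ x_1` for `i > 1`; for `j ≥ 2`,
`f_j(x,1) = x_j`, `f_j(x,2) = x_{j-1} ⋯ x_1 x_n ⋯ x_j`, and `f_j(x,i) = ε` for `i > 2`. -/
def fK (n : ℕ) (a : Fin n) (x : V) (i : ℕ) : List (V × Fin n) :=
  if i = 1 then [(x, a)]
  else if a.val = 0 then ((List.finRange n).reverse).map (fun t => (x, t))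
  else if i = 2 then
    (((List.finRange n).reverse.filter (fun t => decide (t < a))).map (fun t => (x, t))) ++
      (((List.finRange n).reverse.filter (fun t => decide (a ≤ t))).map (fun t => (x, t)))
  else []

/-- The words `pqpq⋯pq`. -/
inductive PairPower {α : Type*} (p q : α) : List α → Prop
  | nil : PairPower p q []
  | cons {l : List α} : PairPower p q l → PairPower p q (p :: q :: l)

namespace PairPower

variable {α β : Type*} {p q : α}

theorem append {l m : List α} (hl : PairPower p q l) (hm : PairPower p q m) :
    PairPower p q (l ++ m) := by
  induction hl with
  | nil => exact hm
  | cons _ ih => exact ih.cons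

theorem flatten {L : List (List α)} (h : ∀ l ∈ L, PairPower p q l) :
    PairPower p q L.flatten := by
  induction L with
  | nil => exact .nil
  | cons l L ih =>
    rw [List.flatten_cons]
    exact (h l (by simp)).append (ih fun m hm => h m (by simp [hm]))

theorem map (f : α → β) {l : List α} (h : PairPower p q l) :
    PairPower (f p) (f q) (l.map f) := by
  induction h with
  | nil => exact .nil
  | cons _ ih => exact ih.cons

theorem isChain_ne (hpq : p ≠ q) {l : List α} (h : PairPower p q l) :
    l.IsChain (· ≠ ·) := by
  suffices (q :: l).IsChain (· ≠ ·) from this.tail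
  induction h with
  | nil => simp
  | cons _ ih => exact .cons_cons hpq.symm (.cons_cons hpq ih)

/-- A word over `{p, q}` in which `p` and `q` alternate, beginning with `p` if nonempty and
containing each of them equally often. -/
theorem of_isChain [DecidableEq α] (hpq : p ≠ q) :
    ∀ {l : List α}, (∀ z ∈ l, z = p ∨ z = q) → (q :: l).IsChain (· ≠ ·) →
      l.count p = l.count q → PairPower p q l
  | [], _, _, _ => .nil
  | [a], h, hc, he => by
    have := h a (by simp)
    simp at hc
    grind
  | a :: b :: l, h, hc, he => by
    obtain ⟨h1, hc⟩ := List.isChain_cons_cons.1 hc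
    obtain ⟨h2, hc⟩ := List.isChain_cons_cons.1 hc
    have ha : a = p := (h a (by simp)).resolve_right h1.symm
    have hb : b = q := (h b (by simp)).resolve_left fun hb => h2 (ha.trans hb.symm)
    rw [ha, hb] at he ⊢
    refine .cons (of_isChain hpq (fun z hz => h z (by simp [hz])) (hb ▸ hc) ?_)
    simpa [List.count_cons, hpq, hpq.symm] using he

theorem or_of_isChain [DecidableEq α] (hpq : p ≠ q) {l : List α}
    (h : ∀ z ∈ l, z = p ∨ z = q) (hc : l.IsChain (· ≠ ·)) (he : l.count p = l.count q) :
    PairPower p q l ∨ PairPower q p l := by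
  cases l with
  | nil => exact .inl .nil
  | cons a l =>
    rcases h a (by simp) with rfl | rfl
    · exact .inl (of_isChain hpq h (.cons_cons hpq.symm hc) he)
    · exact .inr (of_isChain hpq.symm (fun z hz => (h z hz).symm) (.cons_cons hpq hc) he.symm)

end PairPower

section Label

variable {α : Type*} [DecidableEq α]

theorem filter_labelAux (P : α → Bool) {c d : α → ℕ} (h : ∀ x, P x → c x = d x) (w : List α) :
    (labelAux c w).filter (fun p => P p.1) = labelAux d (w.filter P) := by
  induction w generalizing c d with
  | nil => rfl
  | cons a w ih =>
    by_cases ha : P a = true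
    · simp only [labelAux, List.filter_cons, ha, if_true, h a ha]
      rw [ih]
      intro x hx
      by_cases hxa : x = a <;> simp [Function.update, hxa, h x hx]
    · simp only [labelAux, List.filter_cons, ha]
      exact ih fun x hx => by
        have : x ≠ a := by rintro rfl; exact ha hx
        simp [Function.update, this, h x hx]

theorem filter_label (P : α → Bool) (w : List α) :
    (label w).filter (fun p => P p.1) = label (w.filter P) :=
  filter_labelAux P (fun _ _ => rfl) w

theorem map_fst_labelAux (c : α → ℕ) (w : List α) : (labelAux c w).map Prod.fst = w := by
  induction w generalizing c with
  | nil => rfl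
  | cons a w ih => simp [labelAux, ih]

theorem labelAux_replicate (c : α → ℕ) (x : α) (k : ℕ) :
    labelAux c (List.replicate k x) = (List.range k).map fun i => (x, c x + i + 1) := by
  induction k generalizing c with
  | zero => rfl
  | succ k ih =>
    rw [List.replicate_succ, labelAux, ih, List.range_succ_eq_map]
    simp [Function.comp_def]
    omega

theorem lt_of_mem_labelAux {c : α → ℕ} {w : List α} {p : α × ℕ} (h : p ∈ labelAux c w) :
    c p.1 < p.2 := by
  induction w generalizing c with
  | nil => simp [labelAux] at h
  | cons a w ih =>
    rcases List.mem_cons.1 h with rfl | h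
    · simp
    · have := ih h
      by_cases hp : p.1 = a <;> simp_all [Function.update]
      omega

theorem mem_labelAux {c : α → ℕ} {w : List α} {x : α} {i : ℕ} (h : c x < i)
    (hi : i ≤ c x + w.count x) : (x, i) ∈ labelAux c w := by
  induction w generalizing c with
  | nil => simp at hi; omega
  | cons a w ih =>
    rw [labelAux, List.mem_cons]
    by_cases hx : a = x
    · subst hx
      by_cases hic : i = c a + 1
      · simp [hic]
      · exact .inr (ih (by simp; omega) (by simp at hi ⊢; omega))
    · have hx' : x ≠ a := Ne.symm hx
      exact .inr (ih (by simpa [Function.update, hx'] using h)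
        (by simpa [Function.update, hx', List.count_cons, hx] using hi))

theorem mem_label {w : List α} {x : α} {i : ℕ} (h : 0 < i) (hi : i ≤ w.count x) :
    (x, i) ∈ label w :=
  mem_labelAux h (by simpa using hi)

theorem pairwise_labelAux (c : α → ℕ) (w : List α) :
    (labelAux c w).Pairwise fun p q => p.1 = q.1 → p.2 < q.2 := by
  induction w generalizing c with
  | nil => exact .nil
  | cons a w ih =>
    refine .cons (fun q hq h => ?_) (ih _)
    have := lt_of_mem_labelAux hq
    simp only at h
    subst h
    simpa using this

theorem nodup_label (w : List α) : (label w).Nodup :=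
  (pairwise_labelAux _ w).imp fun h hpq => by subst hpq; exact lt_irrefl _ (h rfl)

theorem isChain_labelAux (c : α → ℕ) (w : List α) :
    (labelAux c w).IsChain fun p q => p.1 = q.1 → q.2 = p.2 + 1 := by
  induction w generalizing c with
  | nil => exact .nil
  | cons a w ih =>
    cases w with
    | nil => simp [labelAux]
    | cons b w =>
      refine .cons_cons (fun h => ?_) (ih _)
      simp only at h
      simp [h]

theorem pairPower_map_filter_labelAux {x y : α} (hxy : x ≠ y) (Q : ℕ → Bool) {l : List α}
    (h : PairPower x y l) {c : α → ℕ} (hc : c x = c y) :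
    PairPower x y (((labelAux c l).filter fun p => Q p.2).map Prod.fst) := by
  induction h generalizing c with
  | nil => exact .nil
  | cons _ ih =>
    simp only [labelAux, Function.update_of_ne hxy.symm, List.filter_cons, hc]
    split_ifs
    · exact .cons (ih (by simp [Function.update, hxy]))
    · exact ih (by simp [Function.update, hxy])

end Label

section List

variable {α β : Type*}

theorem isChain_ne_of_filter {L : List (α × ℕ)} (hpos : ∀ p ∈ L, 0 < p.2)
    (hL : L.IsChain fun p q => p.1 = q.1 → q.2 = p.2 + 1) {P Q : ℕ → Bool}
    (hP1 : P 1) (hP2 : P 2) (hQ : ∀ i, 2 ≤ i → Q i)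
    (h₁ : ((L.filter fun p => P p.2).map Prod.fst).IsChain (· ≠ ·))
    (h₂ : ((L.filter fun p => Q p.2).map Prod.fst).IsChain (· ≠ ·)) :
    (L.map Prod.fst).IsChain (· ≠ ·) := by
  induction L with
  | nil => exact .nil
  | cons a L ih =>
    have tail_filter (R : ℕ → Bool)
        (h : (((a :: L).filter fun p => R p.2).map Prod.fst).IsChain (· ≠ ·)) :
        ((L.filter fun p => R p.2).map Prod.fst).IsChain (· ≠ ·) := by
      rw [List.filter_cons] at h
      split_ifs at h
      · exact h.tail
      · exact h
    have ih := ih (fun p hp => hpos p (by simp [hp])) hL.tail (tail_filter P h₁) (tail_filter Q h₂)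
    cases L with
    | nil => simp
    | cons b L =>
      refine .cons_cons (fun hab => ?_) ih
      have hb := (List.isChain_cons_cons.1 hL).1 hab
      have ha := hpos a (by simp)
      rcases Nat.lt_or_ge 1 a.2 with h | h
      · simp [hQ a.2 h, hQ b.2 (by omega), hab] at h₂
      · have ha1 : a.2 = 1 := by omega
        simp [ha1, hP1, hP2, hb, hab] at h₁

/-- If two kept letters have the same image, an alternating image has a different image of a
kept letter between them. -/
theorem exists_between_of_isChain {L : List α} {P : α → Bool} {φ : α → β}
    (hc : ((L.filter P).map φ).IsChain (· ≠ ·)) {a b : α} (hab : [a, b].Sublist L)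
    (ha : P a) (hb : P b) (hφ : φ a = φ b) :
    ∃ z, P z ∧ φ z ≠ φ a ∧ [a, z, b].Sublist L := by
  have hab' : [a, b].Sublist (L.filter P) := by
    simpa [ha, hb] using hab.filter P
  suffices ∃ z ∈ L.filter P, φ z ≠ φ a ∧ [a, z, b].Sublist (L.filter P) by
    obtain ⟨z, hz, hza, hs⟩ := this
    exact ⟨z, (List.mem_filter.1 hz).2, hza, hs.trans List.filter_sublist⟩
  generalize L.filter P = M at hc hab'
  induction M with
  | nil => simp at hab'
  | cons m M ih =>
    rcases List.sublist_cons_iff.1 hab' with h | ⟨r, hr, h⟩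
    · obtain ⟨z, hz, hza, hs⟩ := ih hc.tail h
      exact ⟨z, by simp [hz], hza, hs.cons _⟩
    · obtain ⟨rfl, rfl⟩ : a = m ∧ [b] = r := by simpa using hr
      cases M with
      | nil => simp at h
      | cons z M =>
        have hz : φ a ≠ φ z := (List.isChain_cons_cons.1 hc).1
        have hbz : b ≠ z := by rintro rfl; exact hz hφ
        have hbM : b ∈ M := by simpa [hbz] using h
        exact ⟨z, by simp, hz.symm, by simpa using hbM⟩

theorem filter_eq_singleton {l : List α} (hl : l.Nodup) {Q : α → Bool} {c : α}
    (h : ∀ b ∈ l, Q b → b = c) (hc : c ∈ l) (hQ : Q c) : l.filter Q = [c] := by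
  refine List.perm_singleton.1 ((List.perm_ext_iff_of_nodup (hl.filter _) (by simp)).2 ?_)
  grind

theorem count_filter_of_pos [DecidableEq α] (l : List α) {P : α → Bool} {a : α} (h : P a) :
    (l.filter P).count a = l.count a :=
  List.count_filter h

theorem count_flatten_replicate [DecidableEq α] {l : List α} (hl : l.Nodup) {a : α} (h : a ∈ l)
    (N : ℕ) : (List.replicate N l).flatten.count a = N := by
  simp [List.count_flatten, List.count_eq_one_of_mem hl h]

theorem mem_of_uniform_s9 [DecidableEq α] {k : ℕ} (hk : 0 < k) {l : List α} (h : uniform k l)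
    (a : α) : a ∈ l :=
  List.count_pos_iff.1 (by rwa [h])

theorem flatMap_ite (L : List α) (P : α → Bool) (φ : α → β) :
    (L.flatMap fun p => if P p then [φ p] else []) = (L.filter P).map φ := by
  induction L with
  | nil => rfl
  | cons a L ih => by_cases h : P a <;> simp [List.flatMap_cons, ih, h]

variable [LinearOrder α]

theorem filter_ge_append_filter_lt {l : List α} (h : l.Pairwise (· > ·)) (a : α) :
    l.filter (fun t => decide (a ≤ t)) ++ l.filter (fun t => decide (t < a)) = l := by
  induction l with
  | nil => rfl
  | cons b l ih =>
    obtain ⟨hb, hl⟩ := List.pairwise_cons.1 h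
    rcases le_or_gt a b with hab | hab
    · simp [hab, not_lt.2 hab, ih hl]
    · have h1 : l.filter (fun t => decide (a ≤ t)) = [] := by
        simp only [List.filter_eq_nil_iff, decide_eq_true_eq, not_le]
        exact fun t ht => (hb t ht).trans hab
      have h2 : l.filter (fun t => decide (t < a)) = l := by
        simp only [List.filter_eq_self, decide_eq_true_eq]
        exact fun t ht => (hb t ht).trans hab
      simp [hab, not_le.2 hab, h1, h2]

theorem filter_le_eq_cons {l : List α} (h : l.Pairwise (· > ·)) {a : α} (ha : a ∈ l) :
    l.filter (fun t => decide (t ≤ a)) = a :: l.filter (fun t => decide (t < a)) := by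
  induction l with
  | nil => simp at ha
  | cons b l ih =>
    obtain ⟨hb, hl⟩ := List.pairwise_cons.1 h
    rcases List.mem_cons.1 ha with rfl | ha
    · have : l.filter (fun t => decide (t ≤ a)) = l.filter (fun t => decide (t < a)) :=
        List.filter_congr fun t ht => by simp [(hb t ht).le, show t < a from hb t ht]
      simp [this]
    · have : a < b := hb a ha
      simp [not_le.2 this, not_lt.2 this.le, ih hl ha]

theorem filter_pair {l : List α} (h : l.Pairwise (· > ·)) {s t : α} (hs : s ∈ l) (ht : t ∈ l)
    (hts : t < s) : l.filter (fun z => decide (z = s ∨ z = t)) = [s, t] := by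
  refine List.Perm.eq_of_pairwise (le := (· > ·)) (fun a b _ _ h₁ h₂ => (lt_asymm h₁ h₂).elim)
    (h.filter _) (by simpa using hts) ?_
  refine (List.perm_ext_iff_of_nodup ((h.imp ne_of_gt).filter _) (by simp [hts.ne'])).2 ?_
  grind

end List

theorem pairwise_reverse_finRange (n : ℕ) : (List.finRange n).reverse.Pairwise (· > ·) :=
  List.pairwise_reverse.2 (List.pairwise_lt_finRange n)

section Product

variable {V : Type*} {n : ℕ}

theorem fst_of_mem_fK {a : Fin n} {x : V} {i : ℕ} {p : V × Fin n} (h : p ∈ fK n a x i) :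
    p.1 = x := by
  unfold fK at h
  split_ifs at h <;> simp at h <;> grind

/-- The word `x_n ⋯ x_1`. -/
def descending (n : ℕ) (x : V) : List (V × Fin n) :=
  (List.finRange n).reverse.map fun t => (x, t)

theorem flatMap_fK_zero {a : Fin n} (ha : a.val = 0) (x : V) (k : ℕ) :
    ((List.range (k + 1)).flatMap fun i => fK n a x (i + 1)) =
      (x, a) :: (List.replicate k (descending n x)).flatten := by
  rw [List.range_succ_eq_map, List.flatMap_cons, List.flatMap_map]
  have : (fun i => fK n a x (Nat.succ i + 1)) = fun _ => descending n x := by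
    funext i
    simp [fK, ha, descending]
  rw [this]
  simp [fK, List.flatMap]

theorem flatMap_fK_pos {a : Fin n} (ha : a.val ≠ 0) (x : V) (k : ℕ) :
    ((List.range (k + 2)).flatMap fun i => fK n a x (i + 1)) =
      ((List.finRange n).reverse.filter (fun t => decide (t ≤ a)) ++
        (List.finRange n).reverse.filter (fun t => decide (a ≤ t))).map fun t => (x, t) := by
  rw [filter_le_eq_cons (pairwise_reverse_finRange n) (by simp), List.range_succ_eq_map,
    List.range_succ_eq_map]
  simp [List.flatMap_cons, List.flatMap_map, fK, ha]

/-- Whether the letter `x_t` occurs in `f_a(x,i)`. -/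
def Occurs (a t : Fin n) (i : ℕ) : Prop :=
  if i = 1 then t = a else i = 2 ∨ a.val = 0

instance (a t : Fin n) (i : ℕ) : Decidable (Occurs a t i) := by
  unfold Occurs
  infer_instance

theorem mem_fK {a t : Fin n} {x : V} {i : ℕ} {z : V} :
    (z, t) ∈ fK n a x i ↔ z = x ∧ Occurs a t i := by
  unfold fK Occurs
  split_ifs <;> simp_all [eq_comm]
  have := lt_or_ge t a
  tauto

theorem nodup_fK (a : Fin n) (x : V) (i : ℕ) : (fK n a x i).Nodup := by
  have hR : (List.finRange n).reverse.Nodup := List.nodup_reverse.2 (List.nodup_finRange n)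
  have hinj : Function.Injective fun t : Fin n => (x, t) := fun s t h => (Prod.mk.inj h).2
  unfold fK
  split_ifs
  · simp
  · exact hR.map hinj
  · rw [← List.map_append]
    refine List.Nodup.map hinj ((hR.filter _).append (hR.filter _) ?_)
    intro t h₁ h₂
    simp at h₁ h₂
    exact absurd h₁ (not_lt.2 h₂)
  · simp

variable [DecidableEq V]

theorem filter_fst_obf (a : Fin n) {w : List V} {k : ℕ} (hw : uniform k w) (x : V) :
    (obf (fK n a) w).filter (fun p => decide (p.1 = x)) =
      (List.range k).flatMap fun i => fK n a x (i + 1) := by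
  have h1 : (label w).filter (fun p => decide (p.1 = x)) =
      (List.range k).map fun i => (x, i + 1) := by
    rw [filter_label (fun z => decide (z = x)), ← hw x]
    have : w.filter (fun z => decide (z = x)) = List.replicate (w.count x) x := by
      exact List.filter_eq x
    rw [this, label, labelAux_replicate]
    simp
  have h2 (p : V × ℕ) : (fK n a p.1 p.2).filter (fun q => decide (q.1 = x)) =
      if decide (p.1 = x) then fK n a p.1 p.2 else [] := by
    by_cases hp : p.1 = x
    · simp only [hp, decide_true, if_true, List.filter_eq_self, decide_eq_true_eq]
      exact fun q hq => fst_of_mem_fK hq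
    · simp only [hp, decide_false, Bool.false_eq_true, if_false, List.filter_eq_nil_iff,
        decide_eq_true_eq]
      exact fun q hq h => hp ((fst_of_mem_fK hq).symm.trans h)
  have h3 (L : List (V × ℕ)) :
      (L.flatMap fun p => if decide (p.1 = x) then fK n a p.1 p.2 else []) =
        (L.filter fun p => decide (p.1 = x)).flatMap fun p => fK n a p.1 p.2 := by
    induction L with
    | nil => rfl
    | cons p L ih => by_cases hp : p.1 = x <;> simp [List.flatMap_cons, hp] at ih ⊢ <;> exact ih
  rw [obf, List.filter_flatMap]
  simp only [h2]
  rw [h3, h1, List.flatMap_map]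

/-- The subword of the product word on the letters `x_1, …, x_n` is a power of `x_n ⋯ x_1`. -/
theorem filter_fst_flatten {w : List V} {k : ℕ} (hk : 1 < k) (hn : 0 < n) (hw : uniform k w)
    (x : V) :
    (((List.finRange n).reverse.map fun a => obf (fK n a) w).flatten).filter
        (fun p => decide (p.1 = x)) =
      (List.replicate (k + n - 1) (descending n x)).flatten := by
  obtain ⟨k, rfl⟩ := Nat.exists_eq_add_of_lt hk
  have hR := pairwise_reverse_finRange n
  have key (j : ℕ) (hj : j < n) :
      (((List.finRange n).reverse.filter fun a => decide (a ≤ ⟨j, hj⟩)).flatMap fun a =>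
          (List.range (1 + k + 1)).flatMap fun i => fK n a x (i + 1)) =
        ((List.finRange n).reverse.filter (fun a => decide (a ≤ ⟨j, hj⟩))).map (fun t => (x, t)) ++
          (List.replicate (k + 1 + j) (descending n x)).flatten := by
    induction j with
    | zero =>
      have h0 : (List.finRange n).reverse.filter (fun a => decide (a < ⟨0, hj⟩)) = [] := by
        simp [Fin.lt_def]
      rw [filter_le_eq_cons hR (by simp), h0, List.flatMap_cons, flatMap_fK_zero rfl]
      simp [add_comm]
    | succ j ih =>
      have hj' : j < n := by omega
      have hlt : (List.finRange n).reverse.filter (fun a => decide (a < ⟨j + 1, hj⟩)) =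
          (List.finRange n).reverse.filter (fun a => decide (a ≤ ⟨j, hj'⟩)) :=
        List.filter_congr fun t _ => by simp [Fin.lt_def, Fin.le_def]
      have happ := filter_ge_append_filter_lt hR ⟨j + 1, hj⟩
      rw [hlt] at happ
      have hdesc := congrArg (List.map fun t => (x, t)) happ
      rw [List.map_append, ← descending] at hdesc
      conv_lhs => rw [filter_le_eq_cons hR (by simp), List.flatMap_cons, hlt, ih hj',
        show 1 + k + 1 = k + 2 by omega, flatMap_fK_pos (by simp)]
      rw [List.map_append, List.append_assoc, ← List.append_assoc (List.map _ _) (List.map _ _)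
        (List.flatten _), hdesc, ← add_assoc, List.replicate_succ,
        List.flatten_cons]
  have hall : (List.finRange n).reverse.filter (fun a => decide (a ≤ ⟨n - 1, by omega⟩)) =
      (List.finRange n).reverse := by
    simp only [List.filter_eq_self, decide_eq_true_eq, Fin.le_def]
    intro a _
    omega
  have := key (n - 1) (by omega)
  rw [hall] at this
  rw [← List.flatMap_def, List.filter_flatMap]
  simp only [filter_fst_obf _ hw]
  rw [this, show 1 + k + 1 + n - 1 = (k + 1 + (n - 1)) + 1 by omega, List.replicate_succ,
    List.flatten_cons]
  rfl

theorem filter_pair_obf {x y : V} (hxy : x ≠ y) (a s t : Fin n) (w : List V) :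
    (obf (fK n a) w).filter (fun z => decide (z = (x, s) ∨ z = (y, t))) =
      ((label w).filter fun p => decide ((p.1 = x ∧ Occurs a s p.2) ∨
        (p.1 = y ∧ Occurs a t p.2))).map fun p => (p.1, if p.1 = x then s else t) := by
  rw [obf, List.filter_flatMap, ← flatMap_ite]
  congr 1
  funext p
  have hQ : ∀ b ∈ fK n a p.1 p.2, decide (b = (x, s) ∨ b = (y, t)) →
      b = (p.1, if p.1 = x then s else t) := by
    rintro b hb hQ
    have := fst_of_mem_fK hb
    simp only [decide_eq_true_eq] at hQ
    rcases hQ with rfl | rfl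
    · simp [← this]
    · simp [← this, hxy.symm]
  have hmem : ((p.1, if p.1 = x then s else t) ∈ fK n a p.1 p.2 ∧
      decide ((p.1, if p.1 = x then s else t) = (x, s) ∨
        (p.1, if p.1 = x then s else t) = (y, t))) ↔
      decide ((p.1 = x ∧ Occurs a s p.2) ∨ (p.1 = y ∧ Occurs a t p.2)) := by
    rw [mem_fK]
    by_cases hx : p.1 = x
    · simp [hx, hxy]
    · simp [hx, and_comm]
  by_cases hP : decide ((p.1 = x ∧ Occurs a s p.2) ∨ (p.1 = y ∧ Occurs a t p.2))
  · rw [if_pos hP]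
    exact filter_eq_singleton (nodup_fK a p.1 p.2) hQ (hmem.2 hP).1 (hmem.2 hP).2
  · rw [if_neg hP]
    refine List.filter_eq_nil_iff.2 fun b hb hb' => hP (hmem.1 ?_)
    rw [← hQ b hb hb']
    exact ⟨hb, hb'⟩

theorem filter_pair_obf_self {x y : V} (hxy : x ≠ y) (a t : Fin n) (w : List V) :
    (obf (fK n a) w).filter (fun z => decide (z = (x, t) ∨ z = (y, t))) =
      (((label (w.filter fun z => decide (z = x ∨ z = y))).filter fun p =>
        decide (Occurs a t p.2)).map Prod.fst).map fun z => (z, t) := by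
  rw [filter_pair_obf hxy, ← filter_label, List.filter_filter, List.map_map]
  congr 1
  · simp [Function.comp_def]
  · refine List.filter_congr fun p _ => ?_
    rw [← Bool.decide_and]
    exact decide_eq_decide.2 (by tauto)

theorem alternate_comm_s9 {α : Type*} [DecidableEq α] {w : List α} {p q : α} :
    alternate w p q ↔ alternate w q p := by
  simp only [alternate, or_comm]

theorem filter_flatten_map {α β : Type*} (L : List α) (f : α → List β) (P : β → Bool) :
    (L.map f).flatten.filter P = (L.map fun a => (f a).filter P).flatten := by
  rw [← List.flatMap_def, List.filter_flatMap, List.flatMap_def]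

/-- If two letters alternate in the product word, they alternate in each of its factors. -/
theorem isChain_filter_factor {p q : V × Fin n} {w : List V}
    (h : alternate ((List.finRange n).reverse.map fun a => obf (fK n a) w).flatten p q)
    (a : Fin n) :
    ((obf (fK n a) w).filter fun z => decide (z = p ∨ z = q)).IsChain (· ≠ ·) := by
  unfold alternate at h
  rw [filter_flatten_map] at h
  refine List.IsChain.infix h (List.infix_of_mem_flatten ?_)
  simp

theorem alternate_product_same_fst {w : List V} {k : ℕ} (hk : 1 < k) (hn : 0 < n)
    (hw : uniform k w) (x : V) {s t : Fin n} (hst : t < s) :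
    alternate ((List.finRange n).reverse.map fun a => obf (fK n a) w).flatten (x, s) (x, t) := by
  have h1 (l : List (V × Fin n)) : l.filter (fun z => decide (z = (x, s) ∨ z = (x, t))) =
      (l.filter fun p => decide (p.1 = x)).filter (fun z => decide (z = (x, s) ∨ z = (x, t))) := by
    rw [List.filter_filter]
    refine List.filter_congr fun z _ => ?_
    rw [← Bool.decide_and]
    exact decide_eq_decide.2 (by grind)
  have h2 : (descending n x).filter (fun z => decide (z = (x, s) ∨ z = (x, t))) =
      [(x, s), (x, t)] := by
    rw [descending, List.filter_map]
    simp only [Function.comp_def, Prod.mk.injEq, true_and]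
    rw [filter_pair (pairwise_reverse_finRange n) (by simp) (by simp) hst]
    rfl
  unfold alternate
  rw [h1, filter_fst_flatten hk hn hw, List.filter_flatten, List.map_replicate, h2]
  refine PairPower.isChain_ne (p := (x, s)) (q := (x, t)) (by simp [hst.ne']) (.flatten ?_)
  intro l hl
  rw [List.eq_of_mem_replicate hl]
  exact .cons .nil

theorem alternate_product_same_snd {w : List V} {k : ℕ} (hw : uniform k w) {x y : V}
    (hxy : x ≠ y) (hn : 0 < n) (t : Fin n) :
    alternate ((List.finRange n).reverse.map fun a => obf (fK n a) w).flatten (x, t) (y, t) ↔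
      alternate w x y := by
  have hinj : Function.Injective fun z : V => (z, t) := fun _ _ h => (Prod.mk.inj h).1
  have map_chain {l : List V} : (l.map fun z => (z, t)).IsChain (· ≠ ·) ↔ l.IsChain (· ≠ ·) := by
    rw [List.isChain_map]
    simp
  constructor
  · intro h
    have hf := isChain_filter_factor h
    simp only [filter_pair_obf_self hxy, map_chain] at hf
    unfold alternate
    rw [← map_fst_labelAux (fun _ => 0) (w.filter _)]
    refine isChain_ne_of_filter (P := fun i => decide (Occurs t t i))
      (Q := fun i => decide (Occurs ⟨0, hn⟩ t i)) (fun p hp => lt_of_mem_labelAux hp)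
      (isChain_labelAux _ _)
      ?_ ?_ ?_ (hf t) (hf ⟨0, hn⟩)
    · simp [Occurs]
    · simp [Occurs]
    · intro i hi
      simp [Occurs, show i ≠ 1 by omega]
  · intro h
    have pairPower_product {x y : V} (hxy : x ≠ y)
        (hp : PairPower x y (w.filter fun z => decide (z = x ∨ z = y))) :
        alternate ((List.finRange n).reverse.map fun a => obf (fK n a) w).flatten
          (x, t) (y, t) := by
      unfold alternate
      rw [filter_flatten_map]
      refine PairPower.isChain_ne (p := (x, t)) (q := (y, t)) (by simp [hxy]) (.flatten ?_)
      intro l hl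
      obtain ⟨a, -, rfl⟩ := List.mem_map.1 hl
      rw [filter_pair_obf_self hxy]
      exact PairPower.map (fun z => (z, t)) (pairPower_map_filter_labelAux hxy
        (fun i => decide (Occurs a t i)) hp (c := fun _ => 0) rfl)
    have hcount : (w.filter fun z => decide (z = x ∨ z = y)).count x =
        (w.filter fun z => decide (z = x ∨ z = y)).count y := by
      rw [List.count_filter (by simp), List.count_filter (by simp), hw, hw]
    rcases PairPower.or_of_isChain hxy (fun z hz => by simpa using (List.mem_filter.1 hz).2) h hcount
      with hp | hp
    · exact pairPower_product hxy hp
    · refine alternate_comm_s9.1 (pairPower_product hxy.symm ?_)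
      simpa only [or_comm] using hp

theorem not_alternate_product {w : List V} {k : ℕ} (hk : 1 < k) (hw : uniform k w) {x y : V}
    (hxy : x ≠ y) {s t : Fin n} (hst : t < s) :
    ¬ alternate ((List.finRange n).reverse.map fun a => obf (fK n a) w).flatten
      (x, s) (y, t) := by
  intro h
  have hf := isChain_filter_factor h
  simp only [filter_pair_obf hxy] at hf
  have hs : s.val ≠ 0 := by have := Fin.lt_def.1 hst; omega
  have mem (z : V) (i : ℕ) (h0 : 0 < i) (h2 : i ≤ 2) : (z, i) ∈ label w :=
    mem_label h0 (by rw [hw]; omega)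
  have hidx : (label w).Pairwise fun p q => (label w).idxOf p < (label w).idxOf q := by
    rw [List.pairwise_iff_getElem]
    intro i j hi hj hij
    simpa [(nodup_label w).idxOf_getElem] using hij
  have before {p q : V × ℕ} (h : [p, q].Sublist (label w)) :
      (label w).idxOf p < (label w).idxOf q :=
    List.pairwise_iff_forall_sublist.1 hidx h
  have ordered {p q : V × ℕ} (hp : p ∈ label w) (hq : q ∈ label w) (h1 : p.1 = q.1)
      (h2 : p.2 < q.2) : [p, q].Sublist (label w) := by
    have hsub : (label w).Pairwise fun p q => [p, q].Sublist (label w) :=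
      List.pairwise_iff_forall_sublist.2 fun h => h
    have : Std.Symm fun p q => [p, q].Sublist (label w) ∨ [q, p].Sublist (label w) :=
      ⟨fun _ _ => Or.symm⟩
    have hor := (hsub.imp (S := fun p q => [p, q].Sublist (label w) ∨ [q, p].Sublist (label w))
      Or.inl).forall hp hq (by rintro rfl; exact lt_irrefl _ h2)
    refine hor.resolve_right fun hqp => ?_
    exact lt_asymm h2 (List.pairwise_iff_forall_sublist.1 (pairwise_labelAux _ w) hqp h1.symm)
  obtain ⟨p, hp, hpx, hp'⟩ := exists_between_of_isChain (hf s) (a := (x, 1)) (b := (x, 2))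
    (ordered (mem x 1 (by omega) (by omega)) (mem x 2 (by omega) le_rfl) rfl (by simp))
    (by simp [Occurs]) (by simp [Occurs]) rfl
  obtain ⟨q, hq, hqy, hq'⟩ := exists_between_of_isChain (hf t) (a := (y, 1)) (b := (y, 2))
    (ordered (mem y 1 (by omega) (by omega)) (mem y 2 (by omega) le_rfl) rfl (by simp))
    (by simp [Occurs]) (by simp [Occurs]) rfl
  obtain ⟨p1, p2⟩ := p
  obtain ⟨q1, q2⟩ := q
  obtain ⟨rfl, rfl⟩ : p1 = y ∧ p2 = 2 := by
    simp [Occurs] at hp hpx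
    grind
  obtain ⟨rfl, hq2⟩ : q1 = x ∧ q2 ≠ 1 := by
    simp [Occurs] at hq hqy
    grind
  have hpq := before (List.sublist_of_cons_sublist hp')
  have hqp := before (List.sublist_of_cons_sublist hq')
  have hqmem : (q1, q2) ∈ label w := hq'.subset (by simp)
  have hq0 : 0 < q2 := lt_of_mem_labelAux hqmem
  rcases (show 2 ≤ q2 by omega).eq_or_lt with rfl | hlt
  · omega
  · have := before (ordered (mem q1 2 (by omega) le_rfl) hqmem rfl hlt)
    omega

theorem count_product {w : List V} {k : ℕ} (hk : 1 < k) (hn : 0 < n) (hw : uniform k w) :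
    uniform (k + n - 1) ((List.finRange n).reverse.map fun a => obf (fK n a) w).flatten := by
  rintro ⟨x, t⟩
  rw [← count_filter_of_pos _ (P := fun p => decide (p.1 = x)) (by simp),
    filter_fst_flatten hk hn hw]
  exact count_flatten_replicate ((List.nodup_reverse.2 (List.nodup_finRange n)).map
    fun s t h => (Prod.mk.inj h).2) (by simp) _

end Product

theorem stmt9 {V : Type*} [DecidableEq V] (G : SimpleGraph V) (k n : ℕ)
    (hk : 1 < k) (hn : 1 < n) (w : List V) (hw : uniform k w) (hrep : represents G w) :
    uniform (k + n - 1) ((List.finRange n).reverse.map (fun a => obf (fK n a) w)).flatten ∧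
      represents (G □ (⊤ : SimpleGraph (Fin n)))
        ((List.finRange n).reverse.map (fun a => obf (fK n a) w)).flatten := by
  have hn' : 0 < n := by omega
  have hu := count_product hk hn' hw
  refine ⟨hu, mem_of_uniform_s9 (by omega) hu, ?_⟩
  rintro ⟨x, s⟩ ⟨y, t⟩ hne
  rw [SimpleGraph.boxProd_adj]
  by_cases hxy : x = y
  · subst hxy
    have hst : s ≠ t := fun h => hne (by rw [h])
    simp only [SimpleGraph.irrefl, SimpleGraph.top_adj, ne_eq, hst, not_false_eq_true,
      and_self, or_true, iff_true]
    rcases lt_or_gt_of_ne hst with h | h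
    · exact alternate_comm_s9.1 (alternate_product_same_fst hk hn' hw x h)
    · exact alternate_product_same_fst hk hn' hw x h
  · by_cases hst : s = t
    · subst hst
      simpa [hxy] using (alternate_product_same_snd hw hxy hn' s).trans (hrep.2 x y hxy)
    · simp only [hst, hxy, and_false, or_self, iff_false]
      rcases lt_or_gt_of_ne hst with h | h
      · exact fun ha => not_alternate_product hk hw (Ne.symm hxy) h (alternate_comm_s9.1 ha)
      · exact not_alternate_product hk hw hxy h
end
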